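/- arXiv:2511.09007 — 7 statements merged into one kernel-verified Lean document; each statement's English description precedes it below -/
import Mathlib

section
/- Let ε ≥ 0, let f : ℝ → ℝ be ε-Lipschitz, let t_{n−1} < t_n be real numbers, let μ > 0, and set f̂ = (1/(t_n − t_{n−1})) ∫_{t_{n−1}}^{t_n} f(t) dt. Define the linear bias b_n(t) = ε(t − t_n) − f̂ + ε(t_n − t_{n−1})/2 + μ. Then for every t ≥ t_n, the biased signal satisfies f(t) + b_n(t) ≥ μ > 0 (feasibility of the linear bias). -/
/-- An upper bound on the integral of an `ε`-Lipschitz function over an interval to the left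
of `t`, in terms of its value at `t`. -/
theorem integral_le_of_abs_sub_le {ε : ℝ} {f : ℝ → ℝ}
    (hf : ∀ x y : ℝ, |f x - f y| ≤ ε * |x - y|) {a b t : ℝ} (hab : a ≤ b) (hbt : b ≤ t) :
    ∫ s in a..b, f s ≤ (b - a) * (f t + ε * (t - b) + ε * (b - a) / 2) := by
  have hcont : Continuous f :=
    (LipschitzWith.of_dist_le' (K := ε) fun x y => by
      simpa only [Real.dist_eq] using hf x y).continuous
  have hbound : ∀ s ∈ Set.Icc a b, f s ≤ (f t + ε * t) - ε * s := by
    intro s hs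
    have hst := hf s t
    rw [abs_sub_comm s t, abs_of_nonneg (by linarith [hs.2] : 0 ≤ t - s)] at hst
    linarith [le_abs_self (f s - f t)]
  calc ∫ s in a..b, f s
      ≤ ∫ s in a..b, ((f t + ε * t) - ε * s) :=
        intervalIntegral.integral_mono_on hab (hcont.intervalIntegrable a b)
          (Continuous.intervalIntegrable (by fun_prop) a b) hbound
    _ = (b - a) * (f t + ε * (t - b) + ε * (b - a) / 2) := by
        rw [intervalIntegral.integral_sub (Continuous.intervalIntegrable (by fun_prop) a b)
          (Continuous.intervalIntegrable (by fun_prop) a b),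
          intervalIntegral.integral_const, intervalIntegral.integral_const_mul, integral_id,
          smul_eq_mul]
        ring

/-- Feasibility of the LB-IF-TEM linear bias: with
b_n(t) = ε(t − t_n) − f̂ + ε(t_n − t_{n−1})/2 + μ, the biased signal satisfies
f(t) + b_n(t) ≥ μ > 0 for all t ≥ t_n. -/
theorem linear_bias_feasibility
    (ε : ℝ) (hε : 0 ≤ ε) (f : ℝ → ℝ)
    (hf : ∀ x y : ℝ, |f x - f y| ≤ ε * |x - y|)
    (tnm1 tn : ℝ) (h : tnm1 < tn)
    (μ : ℝ) (hμ : 0 < μ) :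
    ∀ t : ℝ, tn ≤ t →
      f t + (ε * (t - tn)
              - (1 / (tn - tnm1)) * (∫ s in tnm1..tn, f s)
              + ε * (tn - tnm1) / 2 + μ) ≥ μ := by
  intro t ht
  have hpos : 0 < tn - tnm1 := sub_pos.mpr h
  have havg : (1 / (tn - tnm1)) * (∫ s in tnm1..tn, f s)
      ≤ f t + ε * (t - tn) + ε * (tn - tnm1) / 2 := by
    rw [one_div_mul_eq_div, div_le_iff₀' hpos]
    exact integral_le_of_abs_sub_le hf h.le ht
  linarith
end

section
/- Let ε ≥ 0, let f : ℝ → ℝ be ε-Lipschitz, let t_{n−1} < t_n be real numbers, let μ > 0, and set f̂ = (1/(t_n − t_{n−1})) ∫_{t_{n−1}}^{t_n} f(t) dt. Define the linear bias b_n(t) = ε(t − t_n) − f̂ + ε(t_n − t_{n−1})/2 + μ. Then for every t ≥ t_n, the biased signal satisfies f(t) + b_n(t) ≤ 2ε(t − t_n) + ε(t_n − t_{n−1}) + μ. -/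
/-- The value of an `ε`-Lipschitz function at `t ≥ b` exceeds its average over `[a, b]` by at most
`ε` times the distance from `t` to the midpoint of `[a, b]`. -/
theorem sub_average_le_of_lipschitz {ε : ℝ} (hε : 0 ≤ ε) {f : ℝ → ℝ}
    (hf : ∀ x y : ℝ, |f x - f y| ≤ ε * |x - y|) {a b t : ℝ} (hab : a < b) (ht : b ≤ t) :
    f t - (1 / (b - a)) * (∫ s in a..b, f s) ≤ ε * (t - b) + ε * (b - a) / 2 := by
  have hcont : Continuous f := by
    have hlip : LipschitzWith ε.toNNReal f :=
      LipschitzWith.of_dist_le_mul fun x y => by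
        simpa [Real.dist_eq, hε] using hf x y
    exact hlip.continuous
  have hmono : ∫ s in a..b, (f t - ε * t + ε * s) ≤ ∫ s in a..b, f s := by
    refine intervalIntegral.integral_mono_on hab.le
      (Continuous.intervalIntegrable (by fun_prop) _ _) (hcont.intervalIntegrable _ _) ?_
    intro s hs
    have hst := (le_abs_self _).trans (hf t s)
    rw [abs_of_nonneg (by linarith [hs.2])] at hst
    linarith
  have hval : ∫ s in a..b, (f t - ε * t + ε * s)
      = (b - a) * (f t - (ε * (t - b) + ε * (b - a) / 2)) := by
    rw [intervalIntegral.integral_add (Continuous.intervalIntegrable (by fun_prop) _ _)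
      (Continuous.intervalIntegrable (by fun_prop) _ _), intervalIntegral.integral_const,
      intervalIntegral.integral_const_mul, integral_id, smul_eq_mul]
    ring
  rw [hval, mul_comm, ← le_div_iff₀ (sub_pos.mpr hab)] at hmono
  rw [one_div_mul_eq_div]
  linarith

/-- Upper bound on the biased signal in the LB-IF-TEM: with
b_n(t) = ε(t − t_n) − f̂ + ε(t_n − t_{n−1})/2 + μ, the biased signal satisfies
f(t) + b_n(t) ≤ 2ε(t − t_n) + ε(t_n − t_{n−1}) + μ for all t ≥ t_n. -/
theorem linear_bias_upper_bound
    (ε : ℝ) (hε : 0 ≤ ε) (f : ℝ → ℝ)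
    (hf : ∀ x y : ℝ, |f x - f y| ≤ ε * |x - y|)
    (tnm1 tn : ℝ) (h : tnm1 < tn)
    (μ : ℝ) (hμ : 0 < μ) :
    ∀ t : ℝ, tn ≤ t →
      f t + (ε * (t - tn)
              - (1 / (tn - tnm1)) * (∫ s in tnm1..tn, f s)
              + ε * (tn - tnm1) / 2 + μ)
        ≤ 2 * ε * (t - tn) + ε * (tn - tnm1) + μ := by
  intro t ht
  linarith [sub_average_le_of_lipschitz hε hf h ht]
end

section
/- Let ε > 0, let f : ℝ → ℝ be ε-Lipschitz and continuous, let t_{n−1} < t_n < t_{n+1}, let μ > 0, Δ > 0, set f̂ = (1/(t_n − t_{n−1})) ∫_{t_{n−1}}^{t_n} f(t) dt and T_{n−1} = t_n − t_{n−1}, and define b_n(t) = ε(t − t_n) − f̂ + ε T_{n−1}/2 + μ. If ∫_{t_n}^{t_{n+1}} (f(t) + b_n(t)) dt = Δ, then the firing interval T_n = t_{n+1} − t_n satisfies T_n ≥ ( −(ε T_{n−1} + μ) + √((ε T_{n−1} + μ)² + 4εΔ) ) / (2ε). -/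
/-- The integral of an affine function `t ↦ k * (t - c) + m` over `[a, b]`. -/
theorem integral_affine (a b c k m : ℝ) :
    ∫ t in a..b, (k * (t - c) + m)
      = k * ((b - c) ^ 2 - (a - c) ^ 2) / 2 + m * (b - a) := by
  have hd : ∀ t ∈ Set.uIcc a b,
      HasDerivAt (fun t : ℝ => k * (t - c) ^ 2 / 2 + m * t) (k * (t - c) + m) t := by
    intro t _
    have h := ((((hasDerivAt_id t).sub_const c).pow 2).const_mul (k / 2)).add
      ((hasDerivAt_id t).const_mul m)
    refine (h.congr_deriv ?_).congr_of_eventuallyEq (Filter.Eventually.of_forall fun x => ?_)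
    · simp
      ring
    · simp
      ring
  rw [intervalIntegral.integral_eq_sub_of_hasDerivAt hd
    (Continuous.intervalIntegrable (by fun_prop) _ _)]
  ring

/-- The average over `[a, b]` of a function obeying a one-sided Lipschitz bound with constant `ε`
is at least its value at `b` minus `ε * (b - a) / 2`. -/
theorem sub_le_average_of_lipschitz {ε : ℝ} {f : ℝ → ℝ}
    (hf : ∀ x y : ℝ, |f x - f y| ≤ ε * |x - y|) (hcont : Continuous f)
    {a b : ℝ} (hab : a < b) :
    f b - ε * (b - a) / 2 ≤ (1 / (b - a)) * ∫ s in a..b, f s := by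
  have hmono : ∫ s in a..b, (ε * (s - b) + f b) ≤ ∫ s in a..b, f s := by
    refine intervalIntegral.integral_mono_on hab.le
      (Continuous.intervalIntegrable (by fun_prop) _ _) (hcont.intervalIntegrable _ _) ?_
    intro s hs
    have h := (abs_le.mp (hf s b)).1
    rw [abs_of_nonpos (by linarith [hs.2])] at h
    linarith
  rw [integral_affine] at hmono
  have hpos : 0 < b - a := sub_pos.mpr hab
  rw [one_div, inv_mul_eq_div, le_div_iff₀ hpos]
  nlinarith

/-- LB-IF-TEM minimum firing interval: with linear bias
b_n(t) = ε(t − t_n) − f̂ + ε T_{n−1}/2 + μ and threshold equation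
∫_{t_n}^{t_{n+1}} (f + b_n) = Δ, the firing interval T_n = t_{n+1} − t_n satisfies
T_n ≥ (−(ε T_{n−1} + μ) + √((ε T_{n−1} + μ)² + 4εΔ)) / (2ε). -/
theorem lbiftem_min_interval
    (ε : ℝ) (hε : 0 < ε) (f : ℝ → ℝ)
    (hf : ∀ x y : ℝ, |f x - f y| ≤ ε * |x - y|)
    (hcont : Continuous f)
    (tnm1 tn tn1 : ℝ) (h1 : tnm1 < tn) (h2 : tn < tn1)
    (μ Δ : ℝ) (hμ : 0 < μ) (hΔ : 0 < Δ)
    (heq : (∫ t in tn..tn1,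
        (f t + (ε * (t - tn)
                 - (1 / (tn - tnm1)) * (∫ s in tnm1..tn, f s)
                 + ε * (tn - tnm1) / 2 + μ))) = Δ) :
    tn1 - tn ≥
      (-(ε * (tn - tnm1) + μ)
        + Real.sqrt ((ε * (tn - tnm1) + μ) ^ 2 + 4 * ε * Δ)) / (2 * ε) := by
  have havg := sub_le_average_of_lipschitz hf hcont h1
  set F := (1 / (tn - tnm1)) * ∫ s in tnm1..tn, f s
  have hbound : Δ ≤ ∫ t in tn..tn1, (2 * ε * (t - tn) + (ε * (tn - tnm1) + μ)) := by
    rw [← heq]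
    refine intervalIntegral.integral_mono_on h2.le
      (Continuous.intervalIntegrable (by fun_prop) _ _)
      (Continuous.intervalIntegrable (by fun_prop) _ _) ?_
    intro t ht
    have h := (abs_le.mp (hf t tn)).2
    rw [abs_of_nonneg (by linarith [ht.1])] at h
    linarith
  rw [integral_affine] at hbound
  have hP : 0 < ε * (tn - tnm1) := mul_pos hε (sub_pos.mpr h1)
  have hT : 0 < ε * (tn1 - tn) := mul_pos hε (sub_pos.mpr h2)
  have hsqrt : Real.sqrt ((ε * (tn - tnm1) + μ) ^ 2 + 4 * ε * Δ)
      ≤ 2 * (ε * (tn1 - tn)) + (ε * (tn - tnm1) + μ) := by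
    refine Real.sqrt_le_iff.mpr ⟨by linarith, ?_⟩
    have h := mul_le_mul_of_nonneg_left hbound hε.le
    linear_combination 4 * h
  rw [ge_iff_le, div_le_iff₀ (by linarith)]
  linarith
end

section
/- Let ε > 0, T > 0, and 0 < α < β. Set Δ = ε α β T² (β + α) / (β − α) and μ = ε α T (β + α) / (β − α). Then ( −(ε β T + μ) + √((ε β T + μ)² + 4 ε Δ) ) / (2ε) = α T. -/
/-- With Δ = εαβT²(β+α)/(β−α) and μ = εαT(β+α)/(β−α), the
worst-case minimum firing interval (previous interval equal to βT) satisfies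
(−(εβT + μ) + √((εβT + μ)² + 4εΔ)) / (2ε) = αT. -/
theorem lbiftem_min_interval_param_choice
    (ε T α β : ℝ) (hε : 0 < ε) (hT : 0 < T) (hα : 0 < α) (hαβ : α < β)
    (Δ μ : ℝ)
    (hΔ : Δ = ε * α * β * T ^ 2 * (β + α) / (β - α))
    (hμ : μ = ε * α * T * (β + α) / (β - α)) :
    (-(ε * β * T + μ)
       + Real.sqrt ((ε * β * T + μ) ^ 2 + 4 * ε * Δ)) / (2 * ε) = α * T := by
  have hβα : 0 < β - α := sub_pos.2 hαβ
  have hβ : 0 < β := hα.trans hαβ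
  have hμ_pos : 0 < μ := by rw [hμ]; positivity
  have h_root : Δ = ε * (α * T) ^ 2 + (ε * β * T + μ) * (α * T) := by
    rw [hΔ, hμ]
    field_simp [hβα.ne']
    ring
  have h_sq : (ε * β * T + μ) ^ 2 + 4 * ε * Δ
      = (2 * ε * (α * T) + (ε * β * T + μ)) ^ 2 := by
    rw [h_root]
    ring
  rw [h_sq, Real.sqrt_sq (by positivity)]
  field_simp
  ring
end

section
/- Let ε > 0, T > 0, 0 < α < β, and set Δ = ε α β T² (β + α) / (β − α) and μ = ε α T (β + α) / (β − α). Let f : ℝ → ℝ be ε-Lipschitz and continuous. Suppose t_{n−1} < t_n < t_{n+1} are real numbers with t_n − t_{n−1} ≤ β T. Set f̂ = (1/(t_n − t_{n−1})) ∫_{t_{n−1}}^{t_n} f(t) dt and b_n(t) = ε(t − t_n) − f̂ + ε(t_n − t_{n−1})/2 + μ, and suppose ∫_{t_n}^{t_{n+1}} (f(t) + b_n(t)) dt = Δ. Then α T ≤ t_{n+1} − t_n ≤ β T. -/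
theorem abs_integral_sub_left_endpoint_le {ε a b : ℝ} {f : ℝ → ℝ} (hab : a ≤ b)
    (hf : ∀ x y : ℝ, |f x - f y| ≤ ε * |x - y|) (hcont : Continuous f) :
    |(∫ t in a..b, f t) - (b - a) * f a| ≤ ε * (b - a) ^ 2 / 2 := by
  have hbound : ‖∫ t in a..b, (f t - f a)‖ ≤ ∫ t in a..b, ε * (t - a) := by
    refine intervalIntegral.norm_integral_le_of_norm_le hab
      (Filter.Eventually.of_forall fun t ht ↦ ?_)
      (Continuous.intervalIntegrable (by fun_prop) _ _)
    have h := hf t a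
    rwa [abs_of_nonneg (sub_nonneg.2 ht.1.le)] at h
  have hright : ∫ t in a..b, ε * (t - a) = ε * (b - a) ^ 2 / 2 := by
    rw [intervalIntegral.integral_const_mul,
      intervalIntegral.integral_comp_sub_right (fun t ↦ t), integral_id]
    ring
  rwa [intervalIntegral.integral_sub (hcont.intervalIntegrable _ _) (by simp),
    intervalIntegral.integral_const, smul_eq_mul, hright, Real.norm_eq_abs] at hbound

theorem abs_integral_sub_right_endpoint_le {ε a b : ℝ} {f : ℝ → ℝ} (hab : a ≤ b)
    (hf : ∀ x y : ℝ, |f x - f y| ≤ ε * |x - y|) (hcont : Continuous f) :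
    |(∫ t in a..b, f t) - (b - a) * f b| ≤ ε * (b - a) ^ 2 / 2 := by
  have h := abs_integral_sub_left_endpoint_le (f := fun t ↦ f (-t)) (neg_le_neg hab)
    (fun x y ↦ (hf (-x) (-y)).trans_eq (by rw [← neg_sub', abs_neg])) (by fun_prop)
  simpa [intervalIntegral.integral_comp_neg, neg_add_eq_sub] using h

/-- Inductive step of Theorem 1 for the LB-IF-TEM: with
Δ = εαβT²(β+α)/(β−α) and μ = εαT(β+α)/(β−α), if the previous firing interval
satisfies t_n − t_{n−1} ≤ βT and the threshold equation
∫_{t_n}^{t_{n+1}} (f + b_n) = Δ holds for the linear bias b_n, then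
αT ≤ t_{n+1} − t_n ≤ βT. -/
theorem lbiftem_inductive_step
    (ε T α β : ℝ) (hε : 0 < ε) (hT : 0 < T) (hα : 0 < α) (hαβ : α < β)
    (Δ μ : ℝ)
    (hΔ : Δ = ε * α * β * T ^ 2 * (β + α) / (β - α))
    (hμ : μ = ε * α * T * (β + α) / (β - α))
    (f : ℝ → ℝ)
    (hf : ∀ x y : ℝ, |f x - f y| ≤ ε * |x - y|)
    (hcont : Continuous f)
    (tnm1 tn tn1 : ℝ) (h1 : tnm1 < tn) (h2 : tn < tn1)
    (hprev : tn - tnm1 ≤ β * T)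
    (heq : (∫ t in tn..tn1,
        (f t + (ε * (t - tn)
                 - (1 / (tn - tnm1)) * (∫ s in tnm1..tn, f s)
                 + ε * (tn - tnm1) / 2 + μ))) = Δ) :
    α * T ≤ tn1 - tn ∧ tn1 - tn ≤ β * T := by
  have hd : 0 < tn - tnm1 := sub_pos.2 h1
  have hh : 0 < tn1 - tn := sub_pos.2 h2
  have hβα : 0 < β - α := sub_pos.2 hαβ
  have hβ : 0 < β := hα.trans hαβ
  have hμ_pos : 0 < μ := by rw [hμ]; positivity
  have hΔμ : Δ = μ * (β * T) := by rw [hΔ, hμ]; ring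
  have hΔα : Δ = ε * (α * T) ^ 2 + ε * (β * T) * (α * T) + μ * (α * T) := by
    rw [hΔ, hμ]; field_simp; ring
  have hprev_avg := abs_le.1 (abs_integral_sub_right_endpoint_le h1.le hf hcont)
  have hnext := abs_le.1 (abs_integral_sub_left_endpoint_le h2.le hf hcont)
  set m := (1 / (tn - tnm1)) * (∫ s in tnm1..tn, f s) with hm
  have hm_mul : (∫ s in tnm1..tn, f s) = (tn - tnm1) * m := by
    rw [hm]; field_simp
  rw [hm_mul] at hprev_avg
  have hm_upper : m - f tn ≤ ε * (tn - tnm1) / 2 :=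
    le_of_mul_le_mul_left (by linarith [hprev_avg.2]) hd
  have hm_lower : -(ε * (tn - tnm1) / 2) ≤ m - f tn :=
    le_of_mul_le_mul_left (by linarith [hprev_avg.1]) hd
  have hbias : (∫ t in tn..tn1, (ε * (t - tn) - m + ε * (tn - tnm1) / 2 + μ)) =
      ε * (tn1 - tn) ^ 2 / 2 + (tn1 - tn) * (-m + ε * (tn - tnm1) / 2 + μ) := by
    have hsplit : (fun t ↦ ε * (t - tn) - m + ε * (tn - tnm1) / 2 + μ) =
        fun t ↦ ε * (t - tn) + (-m + ε * (tn - tnm1) / 2 + μ) := by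
      ext t; ring
    rw [hsplit, intervalIntegral.integral_add
        (Continuous.intervalIntegrable (by fun_prop) _ _) (by simp),
      intervalIntegral.integral_const_mul,
      intervalIntegral.integral_comp_sub_right (fun t ↦ t), integral_id,
      intervalIntegral.integral_const, smul_eq_mul]
    ring
  rw [intervalIntegral.integral_add (hcont.intervalIntegrable _ _)
    (Continuous.intervalIntegrable (by fun_prop) _ _), hbias] at heq
  have hlow := mul_le_mul_of_nonneg_left hm_lower hh.le
  have hupp := mul_le_mul_of_nonneg_left hm_upper hh.le
  constructor
  · have hΔ_le : Δ ≤ ε * (tn1 - tn) ^ 2 + ε * (β * T) * (tn1 - tn) + μ * (tn1 - tn) := by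
      have hprev' := mul_le_mul_of_nonneg_left hprev (mul_pos hε hh).le
      linarith [hnext.2]
    by_contra! hlt
    have hsq : ε * (tn1 - tn) ^ 2 < ε * (α * T) ^ 2 := by gcongr
    have hlin : ε * (β * T) * (tn1 - tn) < ε * (β * T) * (α * T) := by gcongr
    have hshift : μ * (tn1 - tn) < μ * (α * T) := by gcongr
    linarith
  · exact le_of_mul_le_mul_left (by linarith [hnext.1]) hμ_pos
end

section
/- Let ε > 0, T > 0, 0 < α < β, and set Δ = ε α β T² (β + α) / (β − α) and μ = ε α T (β + α) / (β − α). Let f : ℝ → ℝ be ε-Lipschitz and continuous, and let (t_k)_{k≥0} be a strictly increasing sequence of real numbers such that t_1 − t_0 ≤ β T and, for every n ≥ 1, ∫_{t_n}^{t_{n+1}} (f(t) + b_n(t)) dt = Δ, where b_n(t) = ε(t − t_n) − f̂_{n−1} + ε(t_n − t_{n−1})/2 + μ and f̂_{n−1} = (1/(t_n − t_{n−1})) ∫_{t_{n−1}}^{t_n} f(t) dt. Then for every n ≥ 1, the firing interval satisfies α T ≤ t_{n+1} − t_n ≤ β T. -/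
theorem integral_const_add_mul_sub (a b c k r : ℝ) :
    ∫ s in a..b, (c + k * (s - r)) = c * (b - a) + k * ((b - r) ^ 2 - (a - r) ^ 2) / 2 := by
  rw [intervalIntegral.integral_add (by simp) ((by fun_prop :
    Continuous fun s : ℝ => k * (s - r)).intervalIntegrable _ _)]
  simp only [intervalIntegral.integral_const, intervalIntegral.integral_const_mul,
    intervalIntegral.integral_comp_sub_right (fun x => x), integral_id, smul_eq_mul]
  ring

/-- A Lipschitz function differs from its average over an interval by at most half the Lipschitz
constant times the length, at the right endpoint. -/
theorem abs_sub_average_le {ε : ℝ} {f : ℝ → ℝ} (hf : ∀ x y : ℝ, |f x - f y| ≤ ε * |x - y|)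
    (hcont : Continuous f) {a b : ℝ} (hab : a < b) :
    |f b - (1 / (b - a)) * ∫ u in a..b, f u| ≤ ε * (b - a) / 2 := by
  have hd : 0 < b - a := sub_pos.2 hab
  have hpt : ∀ s ∈ Set.Icc a b, |f b - f s| ≤ ε * (b - s) := fun s hs => by
    simpa [abs_of_nonneg (sub_nonneg.2 hs.2)] using hf b s
  have hlow : ∫ s in a..b, (f b + ε * (s - b)) ≤ ∫ s in a..b, f s :=
    intervalIntegral.integral_mono_on hab.le
      ((by fun_prop : Continuous _).intervalIntegrable _ _) (hcont.intervalIntegrable _ _)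
      fun s hs => by linarith [(abs_le.1 (hpt s hs)).2]
  have hupp : ∫ s in a..b, f s ≤ ∫ s in a..b, (f b + (-ε) * (s - b)) :=
    intervalIntegral.integral_mono_on hab.le
      (hcont.intervalIntegrable _ _) ((by fun_prop : Continuous _).intervalIntegrable _ _)
      fun s hs => by linarith [(abs_le.1 (hpt s hs)).1]
  rw [integral_const_add_mul_sub] at hlow hupp
  have hscale : (b - a) * (f b - (1 / (b - a)) * ∫ u in a..b, f u)
      = f b * (b - a) - ∫ u in a..b, f u := by
    field_simp
  rw [abs_le]
  constructor <;> refine le_of_mul_le_mul_left ?_ hd <;> rw [hscale] <;> nlinarith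

/-- Bounds on the integral of a Lipschitz signal plus the linear bias over one firing interval. -/
theorem biased_integral_bounds {ε μ : ℝ} {f : ℝ → ℝ}
    (hf : ∀ x y : ℝ, |f x - f y| ≤ ε * |x - y|) (hcont : Continuous f)
    {a b c : ℝ} (hab : a < b) (hbc : b < c) :
    let I := ∫ s in b..c, (f s + (ε * (s - b) - (1 / (b - a)) * (∫ u in a..b, f u)
      + ε * (b - a) / 2 + μ))
    μ * (c - b) ≤ I ∧ I ≤ (ε * (c - b) + ε * (b - a) + μ) * (c - b) := by
  intro I
  obtain ⟨havg₁, havg₂⟩ := abs_le.1 (abs_sub_average_le hf hcont hab)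
  have hpt : ∀ s ∈ Set.Icc b c, |f s - f b| ≤ ε * (s - b) := fun s hs => by
    simpa [abs_of_nonneg (sub_nonneg.2 hs.1)] using hf s b
  have hlow : ∫ s in b..c, (μ + 0 * (s - b)) ≤ I :=
    intervalIntegral.integral_mono_on hbc.le
      ((by fun_prop : Continuous _).intervalIntegrable _ _)
      ((by fun_prop : Continuous _).intervalIntegrable _ _)
      fun s hs => by linarith [(abs_le.1 (hpt s hs)).1]
  have hupp : I ≤ ∫ s in b..c, ((ε * (b - a) + μ) + (2 * ε) * (s - b)) :=
    intervalIntegral.integral_mono_on hbc.le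
      ((by fun_prop : Continuous _).intervalIntegrable _ _)
      ((by fun_prop : Continuous _).intervalIntegrable _ _)
      fun s hs => by linarith [(abs_le.1 (hpt s hs)).2]
  rw [integral_const_add_mul_sub] at hlow hupp
  constructor <;> linarith


/-- Theorem 1 of the paper: for the LB-IF-TEM with
Δ = εαβT²(β+α)/(β−α) and μ = εαT(β+α)/(β−α), if the firing times (t_k) form a
strictly increasing sequence with t_1 − t_0 ≤ βT and for every n ≥ 1 satisfy the
threshold equation ∫_{t_n}^{t_{n+1}} (f + b_n) = Δ with the linear bias
b_n(t) = ε(t − t_n) − f̂_{n−1} + ε(t_n − t_{n−1})/2 + μ, then all firing intervals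
satisfy αT ≤ t_{n+1} − t_n ≤ βT for n ≥ 1. -/
theorem lbiftem_all_intervals_bounded
    (ε T α β : ℝ) (hε : 0 < ε) (hT : 0 < T) (hα : 0 < α) (hαβ : α < β)
    (Δ μ : ℝ)
    (hΔ : Δ = ε * α * β * T ^ 2 * (β + α) / (β - α))
    (hμ : μ = ε * α * T * (β + α) / (β - α))
    (f : ℝ → ℝ)
    (hf : ∀ x y : ℝ, |f x - f y| ≤ ε * |x - y|)
    (hcont : Continuous f)
    (t : ℕ → ℝ) (hmono : StrictMono t)
    (hfirst : t 1 - t 0 ≤ β * T)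
    (hfire : ∀ n : ℕ, 1 ≤ n →
      (∫ s in t n..t (n + 1),
        (f s + (ε * (s - t n)
                 - (1 / (t n - t (n - 1))) * (∫ u in t (n - 1)..t n, f u)
                 + ε * (t n - t (n - 1)) / 2 + μ))) = Δ) :
    ∀ n : ℕ, 1 ≤ n → α * T ≤ t (n + 1) - t n ∧ t (n + 1) - t n ≤ β * T := by
  have hβα : 0 < β - α := sub_pos.2 hαβ
  have hβ : 0 < β := hα.trans hαβ
  have hμpos : 0 < μ := by rw [hμ]; positivity
  have hΔμ : Δ = μ * (β * T) := by rw [hΔ, hμ]; ring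
  have hΔα : Δ = (ε * (α * T) + ε * (β * T) + μ) * (α * T) := by
    rw [hΔ, hμ]; field_simp; ring
  have hbounds : ∀ n, μ * (t (n + 2) - t (n + 1)) ≤ Δ ∧
      Δ ≤ (ε * (t (n + 2) - t (n + 1)) + ε * (t (n + 1) - t n) + μ)
        * (t (n + 2) - t (n + 1)) := fun n => by
    rw [← hfire (n + 1) (Nat.le_add_left 1 n)]
    exact biased_integral_bounds hf hcont (hmono n.lt_succ_self) (hmono (n + 1).lt_succ_self)
  have hupper : ∀ n, t (n + 1) - t n ≤ β * T := by
    rintro (_ | n)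
    · exact hfirst
    · exact le_of_mul_le_mul_left (hΔμ ▸ (hbounds n).1) hμpos
  rintro (_ | n) hn
  · omega
  refine ⟨?_, hupper (n + 1)⟩
  by_contra! hlt
  have hpos : 0 < t (n + 2) - t (n + 1) := sub_pos.2 (hmono (n + 1).lt_succ_self)
  have hΔle := (hbounds n).2
  have hfactor : ε * (t (n + 2) - t (n + 1)) + ε * (t (n + 1) - t n) + μ
      ≤ ε * (α * T) + ε * (β * T) + μ := by
    gcongr
    exact hupper n
  have hΔlt : (ε * (t (n + 2) - t (n + 1)) + ε * (t (n + 1) - t n) + μ)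
      * (t (n + 2) - t (n + 1)) < (ε * (α * T) + ε * (β * T) + μ) * (α * T) :=
    mul_lt_mul' hfactor hlt hpos.le (by positivity)
  linarith
end

section
/- Let ε > 0, μ > 0, Δ > 0, let f : ℝ → ℝ be ε-Lipschitz and continuous, and let t_{n−1} < t_n. Set f̂ = (1/(t_n − t_{n−1})) ∫_{t_{n−1}}^{t_n} f(t) dt and b_n(t) = ε(t − t_n) − f̂ + ε(t_n − t_{n−1})/2 + μ. Then there exists a unique t_{n+1} > t_n such that ∫_{t_n}^{t_{n+1}} (f(t) + b_n(t)) dt = Δ. -/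
theorem intervalIntegral_ge_of_lower_bound {g : ℝ → ℝ} (hg : Continuous g) {m a b : ℝ}
    (hab : a ≤ b) (hm : ∀ t, a ≤ t → m ≤ g t) : m * (b - a) ≤ ∫ t in a..b, g t := by
  have key : ∫ _ in a..b, m ≤ ∫ t in a..b, g t :=
    intervalIntegral.integral_mono_on hab intervalIntegrable_const
      (hg.intervalIntegrable a b) fun t ht => hm t ht.1
  rw [intervalIntegral.integral_const, smul_eq_mul] at key
  linarith

/-- The primitive of a continuous function with a positive lower bound on `[a, ∞)` takes each
positive value exactly once there. -/
theorem existsUnique_intervalIntegral_eq {g : ℝ → ℝ} (hg : Continuous g) {m a Δ : ℝ}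
    (hm : 0 < m) (hΔ : 0 < Δ) (hgm : ∀ t, a ≤ t → m ≤ g t) :
    ∃! b, a < b ∧ ∫ t in a..b, g t = Δ := by
  have mono : ∀ b c, a ≤ b → b < c → ∫ t in a..b, g t < ∫ t in a..c, g t := by
    intro b c hab hbc
    have hadd := intervalIntegral.integral_add_adjacent_intervals
      (hg.intervalIntegrable (μ := MeasureTheory.volume) a b) (hg.intervalIntegrable b c)
    have hge := intervalIntegral_ge_of_lower_bound hg hbc.le fun t ht => hgm t (hab.trans ht)
    have hpos : 0 < m * (c - b) := mul_pos hm (sub_pos.2 hbc)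
    linarith
  have hle : a ≤ a + Δ / m := le_add_of_nonneg_right (div_pos hΔ hm).le
  have hend : Δ ≤ ∫ t in a..(a + Δ / m), g t := by
    have := intervalIntegral_ge_of_lower_bound hg hle hgm
    rwa [add_sub_cancel_left, mul_div_cancel₀ _ hm.ne'] at this
  have hcont : Continuous fun b => ∫ t in a..b, g t :=
    intervalIntegral.continuous_primitive (fun c d => hg.intervalIntegrable c d) a
  obtain ⟨b, hb, hbΔ⟩ := intermediate_value_Icc hle hcont.continuousOn
    ⟨by simpa using hΔ.le, hend⟩
  refine ⟨b, ⟨lt_of_le_of_ne hb.1 ?_, hbΔ⟩, ?_⟩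
  · rintro rfl
    simp at hbΔ
    exact hΔ.ne hbΔ
  · rintro c ⟨hc, hcΔ⟩
    dsimp only at hbΔ
    rcases lt_trichotomy c b with hlt | heq | hlt
    · exact absurd (mono c b hc.le hlt) (by rw [hcΔ, hbΔ]; exact lt_irrefl _)
    · exact heq
    · exact absurd (mono b c hb.1 hlt) (by rw [hcΔ, hbΔ]; exact lt_irrefl _)

/-- The average of a Lipschitz function over `[a, b]` exceeds its value at `b` by at most half the
length of the interval times the Lipschitz constant. -/
theorem average_le_right_endpoint_add {f : ℝ → ℝ} (hcont : Continuous f) {ε a b : ℝ}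
    (hf : ∀ x y : ℝ, |f x - f y| ≤ ε * |x - y|) (hab : a < b) :
    1 / (b - a) * ∫ s in a..b, f s ≤ f b + ε * (b - a) / 2 := by
  have hlen : 0 < b - a := sub_pos.2 hab
  have hint : ∫ s in a..b, f s ≤ ∫ s in a..b, ((f b + ε * b) - ε * s) := by
    refine intervalIntegral.integral_mono_on hab.le (hcont.intervalIntegrable a b)
      (Continuous.intervalIntegrable (by fun_prop) a b) fun s hs => ?_
    have h1 := (le_abs_self _).trans (hf s b)
    rw [abs_sub_comm s b, abs_of_nonneg (sub_nonneg.2 hs.2)] at h1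
    linarith
  have hval : ∫ s in a..b, ((f b + ε * b) - ε * s)
      = (f b + ε * (b - a) / 2) * (b - a) := by
    rw [intervalIntegral.integral_sub intervalIntegrable_const
      (Continuous.intervalIntegrable (by fun_prop) a b), intervalIntegral.integral_const,
      intervalIntegral.integral_const_mul, integral_id, smul_eq_mul]
    ring
  rw [one_div_mul_eq_div, div_le_iff₀ hlen, ← hval]
  exact hint

/-- Well-definedness of the LB-IF-TEM firing sequence: with the
linear bias b_n(t) = ε(t − t_n) − f̂ + ε(t_n − t_{n−1})/2 + μ (μ > 0, Δ > 0) there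
exists a unique t_{n+1} > t_n with ∫_{t_n}^{t_{n+1}} (f + b_n) = Δ. -/
theorem lbiftem_next_firing_exists_unique
    (ε μ Δ : ℝ) (hε : 0 < ε) (hμ : 0 < μ) (hΔ : 0 < Δ)
    (f : ℝ → ℝ)
    (hf : ∀ x y : ℝ, |f x - f y| ≤ ε * |x - y|)
    (hcont : Continuous f)
    (tnm1 tn : ℝ) (h : tnm1 < tn) :
    ∃! tn1 : ℝ, tn < tn1 ∧
      (∫ t in tn..tn1,
        (f t + (ε * (t - tn)
                 - (1 / (tn - tnm1)) * (∫ s in tnm1..tn, f s)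
                 + ε * (tn - tnm1) / 2 + μ))) = Δ := by
  refine existsUnique_intervalIntegral_eq (by fun_prop) hμ hΔ fun t ht => ?_
  have havg := average_le_right_endpoint_add hcont hf h
  have h1 := (neg_le_abs _).trans (hf t tn)
  rw [abs_of_nonneg (sub_nonneg.2 ht)] at h1
  linarith
end
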